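/- If a finite group G acts on the finite game Γ, then the set XE_G^∞(Γ) = ⋂_{m=1}^∞ μ_m^{-1}(XE_G^m(Γ)) of order ∞ G-exchangeable equilibria is a nonempty, convex, compact subset of Δ(Δ_G^Π(Γ)) with the weak topology. -/

import Mathlib

open Finset
open scoped Classical BigOperators
open MeasureTheory
open scoped NNReal ENNReal

/-- An action of a group `G` on a finite game with player set `I`, strategy sets `C i`
and utilities `u`.  `actI` is the left action on players and `actS` the induced left
action on strategy profiles; `diagonal` expresses that the coordinate `g·i` of `g·s`
depends only on the coordinate `i` of `s` (i.e. the profile action is induced by strategy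
maps `g· : C i → C (g·i)`), and `utility_inv` is the utility compatibility condition
`u_{g·i}(g·s) = u_i(s)`. -/
structure GameAction (G : Type*) [Group G] {I : Type*} (C : I → Type*)
    (u : ∀ i : I, (∀ j, C j) → ℝ) where
  actI : G → I → I
  actS : G → (∀ j, C j) → (∀ j, C j)
  actI_one : ∀ i, actI 1 i = i
  actI_mul : ∀ g h i, actI (g * h) i = actI g (actI h i)
  actS_one : ∀ s, actS 1 s = s
  actS_mul : ∀ g h s, actS (g * h) s = actS g (actS h s)
  diagonal : ∀ g s t i, s i = t i → actS g s (actI g i) = actS g t (actI g i)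
  utility_inv : ∀ g i s, u (actI g i) (actS g s) = u i s

/-- The action of `G × S_m` on the common profile set `C^m` of the powers `Γ^{Πm}` and
`Γ^{⊗m}`: `g` is applied in every copy (via the action of `G` on `Γ`) and `σ ∈ S_m`
permutes the copies. -/
def powAct {G : Type*} [Group G] {I : Type*} {C : I → Type*}
    {u : ∀ i : I, (∀ j, C j) → ℝ} (A : GameAction G C u) (m : ℕ)
    (g : G) (σ : Equiv.Perm (Fin m)) (s : ∀ i, Fin m → C i) : ∀ i, Fin m → C i :=
  fun i j => A.actS g (fun k => s k (σ⁻¹ j)) i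

/-- The `(G × S_m)`-invariant functions on profiles of the `m`-th powers. -/
def powInv {G : Type*} [Group G] {I : Type*} {C : I → Type*}
    {u : ∀ i : I, (∀ j, C j) → ℝ} (A : GameAction G C u) (m : ℕ) :
    Set ((∀ i, Fin m → C i) → ℝ) :=
  {π | ∀ (g : G) (σ : Equiv.Perm (Fin m)), (fun s => π (powAct A m g σ s)) = π}

/-- Utility of player `(i,j)` in the `m`-th power `Γ^{Πm}`. -/
noncomputable def uPow {I : Type*} {C : I → Type*}
    (u : ∀ i : I, (∀ j, C j) → ℝ) (m : ℕ) (i : I) (j : Fin m)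
    (s : ∀ k, Fin m → C k) : ℝ :=
  u i (fun k => s k j)

/-- Utility of player `i` in the contracted `m`-th power `Γ^{⊗m}`. -/
noncomputable def uTen {I : Type*} {C : I → Type*}
    (u : ∀ i : I, (∀ j, C j) → ℝ) (m : ℕ) (i : I) (s : ∀ k, Fin m → C k) : ℝ :=
  ∑ j : Fin m, u i (fun k => s k j)

/-- Product distributions of `Γ^{Πm}`: products over all `mn` players `(i,j)`. -/
def prodPow {I : Type*} [Fintype I] (C : I → Type*) [∀ i, Fintype (C i)] (m : ℕ) :
    Set ((∀ i, Fin m → C i) → ℝ) :=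
  {π | ∃ ρ : ∀ i, Fin m → C i → ℝ, (∀ i j, ρ i j ∈ stdSimplex ℝ (C i)) ∧
        π = fun s => ∏ i, ∏ j, ρ i j (s i j)}

/-- Product distributions of `Γ^{⊗m}`: products over the `n` players `i`. -/
def prodTen {I : Type*} [Fintype I] (C : I → Type*) [∀ i, Fintype (C i)] (m : ℕ) :
    Set ((∀ i, Fin m → C i) → ℝ) :=
  {π | ∃ ρ : ∀ i, (Fin m → C i) → ℝ, (∀ i, ρ i ∈ stdSimplex ℝ (Fin m → C i)) ∧
        π = fun s => ∏ i, ρ i (s i)}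

/-- Correlated equilibria of the contracted `m`-th power `Γ^{⊗m}`:
player `i` may deviate based on the whole recommendation `s i`. -/
def ceTen {I : Type*} [Fintype I] {C : I → Type*} [∀ i, Fintype (C i)]
    (u : ∀ i : I, (∀ j, C j) → ℝ) (m : ℕ) : Set ((∀ i, Fin m → C i) → ℝ) :=
  {π | π ∈ stdSimplex ℝ (∀ i, Fin m → C i) ∧
    ∀ (i : I) (r t : Fin m → C i),
      ∑ s : ∀ k, Fin m → C k,
        (if s i = r then (uTen u m i (Function.update s i t) - uTen u m i s) * π s
         else 0) ≤ 0}

/-- The set `Δ_G^Π(Γ)` of `G`-invariant product distributions, as a subset of the space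
of real-valued functions on profiles. -/
def gInvProd {G : Type*} [Group G] {I : Type*} [Fintype I] {C : I → Type*}
    [∀ i, Fintype (C i)] {u : ∀ i : I, (∀ j, C j) → ℝ} (A : GameAction G C u) :
    Set ((∀ j, C j) → ℝ) :=
  {π | (∃ ρ : ∀ i, C i → ℝ, (∀ i, ρ i ∈ stdSimplex ℝ (C i)) ∧
          π = fun s => ∏ i, ρ i (s i)) ∧
        ∀ g : G, (fun s => π (A.actS g s)) = π}

/-- The map `μ_m : Δ(Δ_G^Π(Γ)) → Δ(C^m)`, sending a Borel probability measure `π` on the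
(compact) set of `G`-invariant product distributions to the mixture `∫ ρ^{⊗m} dπ(ρ)` of
the `m`-fold products `ρ^{⊗m}(s) = ∏_j ρ(s¹ʲ,…,sⁿʲ)`. -/
noncomputable def muM {G : Type*} [Group G] {I : Type*} [Fintype I] {C : I → Type*}
    [∀ i, Fintype (C i)] {u : ∀ i : I, (∀ j, C j) → ℝ} (A : GameAction G C u) (m : ℕ)
    (π : MeasureTheory.ProbabilityMeasure ↥(gInvProd A)) : (∀ i, Fin m → C i) → ℝ :=
  fun s =>
    ∫ ρ, (∏ j : Fin m, (ρ : (∀ j, C j) → ℝ) (fun i => s i j))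
      ∂(π : MeasureTheory.Measure ↥(gInvProd A))

/-- The set `XE_G^m(Γ) = Δ^X_{G×S_m}(Γ^{Πm}) ∩ CE_{G×S_m}(Γ^{⊗m})` of order `m`
`G`-exchangeable equilibria. -/
def xeM {G : Type*} [Group G] {I : Type*} [Fintype I] {C : I → Type*}
    [∀ i, Fintype (C i)] {u : ∀ i : I, (∀ j, C j) → ℝ} (A : GameAction G C u) (m : ℕ) :
    Set ((∀ i, Fin m → C i) → ℝ) :=
  convexHull ℝ (prodPow C m ∩ powInv A m) ∩ (ceTen u m ∩ powInv A m)

/-- The set `XE_G^∞(Γ) = ⋂_{m ≥ 1} μ_m⁻¹(XE_G^m(Γ))` of order `∞` `G`-exchangeable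
equilibria, a set of Borel probability measures on `Δ_G^Π(Γ)`. -/
def xeInf {G : Type*} [Group G] {I : Type*} [Fintype I] {C : I → Type*}
    [∀ i, Fintype (C i)] {u : ∀ i : I, (∀ j, C j) → ℝ} (A : GameAction G C u) :
    Set (MeasureTheory.ProbabilityMeasure ↥(gInvProd A)) :=
  ⋂ (m : ℕ) (_ : 1 ≤ m), muM A m ⁻¹' xeM A m

section Brouwer

open Module Metric Function

variable {E : Type*} [NormedAddCommGroup E] [NormedSpace ℝ E] [FiniteDimensional ℝ E]

lemma det_smul_id_add_pos {A : E →L[ℝ] E} {c : ℝ} (hc : ‖A‖ < c) :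
    0 < (c • ContinuousLinearMap.id ℝ E + A).det := by
  have hc0 : 0 < c := (norm_nonneg A).trans_lt hc
  have hcont : Continuous fun t : ℝ => (c • ContinuousLinearMap.id ℝ E + t • A).det :=
    ContinuousLinearMap.continuous_det.comp (by fun_prop)
  have hne : ∀ t ∈ Set.Icc (0 : ℝ) 1, (c • ContinuousLinearMap.id ℝ E + t • A).det ≠ 0 := by
    intro t ht h0
    obtain ⟨x, hx, hx0⟩ := (LinearMap.bot_lt_ker_of_det_eq_zero h0).ne_bot |>
      Submodule.exists_mem_ne_zero_of_ne_bot
    have h1 : c • x = -(t • A x) := by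
      have : c • x + t • A x = 0 := by simpa using hx
      exact eq_neg_of_add_eq_zero_left this
    have h2 : c * ‖x‖ ≤ ‖A‖ * ‖x‖ := by
      calc c * ‖x‖ = ‖c • x‖ := by rw [norm_smul, Real.norm_of_nonneg hc0.le]
        _ = t * ‖A x‖ := by rw [h1, norm_neg, norm_smul, Real.norm_of_nonneg ht.1]
        _ ≤ 1 * ‖A x‖ := by gcongr; exact ht.2
        _ ≤ ‖A‖ * ‖x‖ := by rw [one_mul]; exact A.le_opNorm x
    exact absurd (le_of_mul_le_mul_right h2 (norm_pos_iff.2 hx0)) (not_le.2 hc)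
  by_contra! hle
  have h0 : 0 ≤ (c • ContinuousLinearMap.id ℝ E + (0 : ℝ) • A).det := by
    simp [ContinuousLinearMap.det, hc0.le]
  obtain ⟨t, ht, hz⟩ := intermediate_value_Icc' zero_le_one hcont.continuousOn
    (show (0 : ℝ) ∈ Set.Icc _ _ from ⟨by simpa using hle, h0⟩)
  exact hne t ht hz

lemma bijective_smul_add_of_lipschitzWith {P : E → E} {K : ℝ≥0} (hP : LipschitzWith K P)
    {c : ℝ≥0} (hc : K < c) : Bijective fun x => (c : ℝ) • x + P x := by
  have hc0 : (0 : ℝ) < c := by exact_mod_cast (zero_le (a := K)).trans_lt hc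
  have hcne : c ≠ 0 := ((zero_le (a := K)).trans_lt hc).ne'
  have hcon : ∀ y, ContractingWith (c⁻¹ * K) fun x => (c : ℝ)⁻¹ • (y - P x) := by
    intro y
    refine ⟨by rw [inv_mul_lt_iff₀ (pos_of_ne_zero hcne)]; simpa using hc, ?_⟩
    refine LipschitzWith.of_dist_le_mul fun a b => ?_
    have := hP.dist_le_mul a b
    rw [dist_smul₀, dist_sub_left, NNReal.coe_mul, mul_assoc, NNReal.coe_inv]
    simp only [norm_inv, Real.norm_of_nonneg hc0.le]
    gcongr
  have key : ∀ x y, (c : ℝ) • x + P x = y ↔ IsFixedPt (fun x => (c : ℝ)⁻¹ • (y - P x)) x := by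
    intro x y
    rw [IsFixedPt, inv_smul_eq_iff₀ hc0.ne', sub_eq_iff_eq_add, eq_comm]
  refine ⟨fun a b hab => ?_, fun y => ?_⟩
  · exact (hcon _).fixedPoint_unique' ((key a _).1 rfl) ((key b _).1 hab.symm)
  · exact ⟨_, (key _ y).2 (hcon y).fixedPoint_isFixedPt⟩

variable [MeasurableSpace E] [BorelSpace E] (μ : Measure E) [μ.IsAddHaarMeasure]

lemma LipschitzWith.addHaar_image_eq_zero {f : E → E} {K : ℝ≥0} (hf : LipschitzWith K f)
    {s : Set E} (hs : μ s = 0) : μ (f '' s) = 0 := by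
  have hac : ∀ ν ν' : Measure E, ν.IsAddHaarMeasure → ν'.IsAddHaarMeasure → ν ≪ ν' :=
    fun ν ν' _ _ => Measure.absolutelyContinuous_isAddHaarMeasure ν ν'
  refine hac μ μH[finrank ℝ E] inferInstance inferInstance ?_
  refine le_antisymm ((hf.hausdorffMeasure_image_le (Nat.cast_nonneg _) s).trans ?_) zero_le
  rw [hac μH[finrank ℝ E] μ inferInstance inferInstance hs, mul_zero]

lemma setIntegral_det_smul_id_add_fderiv {P : E → E} {K : ℝ≥0} (hP : LipschitzWith K P)
    {c : ℝ≥0} (hc : K < c) {s : Set E} (hs : MeasurableSet s) (hb : Bornology.IsBounded s) :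
    IntegrableOn (fun x => ((c : ℝ) • ContinuousLinearMap.id ℝ E + fderiv ℝ P x).det) s μ ∧
    ∫ x in s, ((c : ℝ) • ContinuousLinearMap.id ℝ E + fderiv ℝ P x).det ∂μ =
      μ.real ((fun x => (c : ℝ) • x + P x) '' s) := by
  set φ : E → E := fun x => (c : ℝ) • x + P x with hφ
  set J : E → ℝ := fun x => ((c : ℝ) • ContinuousLinearMap.id ℝ E + fderiv ℝ P x).det with hJ
  have hφL : LipschitzWith (c + K) φ := by
    refine LipschitzWith.add ?_ hP
    simpa using lipschitzWith_smul (β := E) (c : ℝ)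
  have hJpos : ∀ x, 0 < J x := fun x => det_smul_id_add_pos
    ((norm_fderiv_le_of_lipschitz ℝ hP).trans_lt (by exact_mod_cast hc))
  have hJm : Measurable J := ContinuousLinearMap.continuous_det.measurable.comp
    ((measurable_fderiv ℝ P).const_add _)
  set D : Set E := {x | DifferentiableAt ℝ P x}
  have hD : MeasurableSet D := measurableSet_of_differentiableAt ℝ P
  have hDae : μ Dᶜ = 0 := hP.ae_differentiableAt
  have himg : μ (φ '' (s ∩ D)) = μ (φ '' s) := by
    refine le_antisymm (measure_mono (Set.image_mono Set.inter_subset_left)) ?_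
    calc μ (φ '' s) ≤ μ (φ '' (s ∩ D) ∪ φ '' Dᶜ) := by
          rw [← Set.image_union]
          exact measure_mono (Set.image_mono fun x hx => by
            by_cases h : x ∈ D <;> simp [hx, h])
      _ ≤ μ (φ '' (s ∩ D)) + μ (φ '' Dᶜ) := measure_union_le _ _
      _ = μ (φ '' (s ∩ D)) := by rw [hφL.addHaar_image_eq_zero μ hDae, add_zero]
  have hlin : ∫⁻ x in s, ENNReal.ofReal (J x) ∂μ = μ (φ '' s) := by
    rw [← himg, ← lintegral_abs_det_fderiv_eq_addHaar_image μ (hs.inter hD)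
      (f' := fun x => (c : ℝ) • ContinuousLinearMap.id ℝ E + fderiv ℝ P x)]
    · have : (s ∩ D : Set E) =ᵐ[μ] s := inter_ae_eq_left_of_ae_eq_univ
        (ae_eq_univ.2 hDae)
      rw [Measure.restrict_congr_set this]
      exact lintegral_congr fun x => by rw [abs_of_pos (hJpos x)]
    · intro x hx
      exact (((hasFDerivAt_id x).const_smul (c : ℝ)).add hx.2.hasFDerivAt).hasFDerivWithinAt
    · exact (bijective_smul_add_of_lipschitzWith hP hc).1.injOn
  have hfin : μ (φ '' s) < ⊤ := (hφL.isBounded_image hb).measure_lt_top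
  refine ⟨⟨hJm.aestronglyMeasurable, ?_⟩, ?_⟩
  · rw [hasFiniteIntegral_iff_ofReal (ae_of_all _ fun x => (hJpos x).le), hlin]
    exact hfin
  · rw [integral_eq_lintegral_of_nonneg_ae (ae_of_all _ fun x => (hJpos x).le)
      hJm.aestronglyMeasurable, hlin, Measure.real]

lemma exists_det_eq_sum_det_smul_id_add (E : Type*) [NormedAddCommGroup E] [NormedSpace ℝ E]
    [FiniteDimensional ℝ E] (c : ℕ → ℝ) (hc : Injective c) :
    ∃ w : ℕ → ℝ, ∀ A : E →L[ℝ] E, A.det =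
      ∑ k ∈ range (finrank ℝ E + 1), w k * (c k • ContinuousLinearMap.id ℝ E + A).det := by
  refine ⟨fun k => (Lagrange.basis (range (finrank ℝ E + 1)) c k).eval 0, fun A => ?_⟩
  set p := LinearMap.charpoly (-(A : E →ₗ[ℝ] E)) with hp
  have hev : ∀ t : ℝ, p.eval t = (t • ContinuousLinearMap.id ℝ E + A).det := by
    intro t
    rw [hp, LinearMap.eval_charpoly, ContinuousLinearMap.det, sub_neg_eq_add]
    congr 1
  have hdeg : p.degree < (#(range (finrank ℝ E + 1)) : WithBot ℕ) := by
    rw [Polynomial.degree_eq_natDegree (LinearMap.charpoly_monic _).ne_zero,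
      LinearMap.charpoly_natDegree, card_range]
    exact_mod_cast Nat.lt_succ_self _
  have h0 := hev 0
  rw [zero_smul, zero_add, Lagrange.eq_interpolate hc.injOn hdeg, Lagrange.interpolate_apply,
    Polynomial.eval_finsetSum] at h0
  rw [← h0]
  refine sum_congr rfl fun k _ => ?_
  rw [Polynomial.eval_mul, Polynomial.eval_C, hev, mul_comm]

/-- The integral of the Jacobian determinant of a Lipschitz map over a bounded set is determined by
the values of the map outside of that set. -/
theorem setIntegral_det_fderiv_eq_of_eqOn_compl {P Q : E → E} {K K' : ℝ≥0}
    (hP : LipschitzWith K P) (hQ : LipschitzWith K' Q) {s : Set E} (hs : MeasurableSet s)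
    (hb : Bornology.IsBounded s) (hPQ : Set.EqOn P Q sᶜ) :
    ∫ x in s, (fderiv ℝ P x).det ∂μ = ∫ x in s, (fderiv ℝ Q x).det ∂μ := by
  set c : ℕ → ℝ≥0 := fun k => K + K' + 1 + k with hc
  have hcP : ∀ k, K < c k := fun k => by
    rw [hc]; dsimp only; rw [add_assoc, add_assoc]; exact lt_add_of_pos_right _ (by positivity)
  have hcQ : ∀ k, K' < c k := fun k => by
    rw [hc]; dsimp only; rw [add_comm K, add_assoc, add_assoc]
    exact lt_add_of_pos_right _ (by positivity)
  obtain ⟨w, hw⟩ := exists_det_eq_sum_det_smul_id_add E (fun k => (c k : ℝ))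
    (fun a b hab => by
      have : K + K' + 1 + (a : ℝ≥0) = K + K' + 1 + (b : ℝ≥0) := NNReal.coe_injective hab
      exact_mod_cast add_left_cancel this)
  have hint : ∀ {R : E → E} {L : ℝ≥0}, LipschitzWith L R → (∀ k, L < c k) →
      ∫ x in s, (fderiv ℝ R x).det ∂μ = ∑ k ∈ range (finrank ℝ E + 1),
        w k * μ.real ((fun x => (c k : ℝ) • x + R x) '' s) := by
    intro R L hR hL
    rw [integral_congr_ae (ae_of_all _ fun x => hw (fderiv ℝ R x))]
    rw [integral_finsetSum _ fun k _ =>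
      ((setIntegral_det_smul_id_add_fderiv μ hR (hL k) hs hb).1.const_mul _)]
    refine sum_congr rfl fun k _ => ?_
    rw [integral_const_mul, (setIntegral_det_smul_id_add_fderiv μ hR (hL k) hs hb).2]
  rw [hint hP hcP, hint hQ hcQ]
  refine sum_congr rfl fun k _ => ?_
  congr 2
  have h1 := Set.image_compl_eq (s := s) (bijective_smul_add_of_lipschitzWith hP (hcP k))
  have h2 := Set.image_compl_eq (s := s) (bijective_smul_add_of_lipschitzWith hQ (hcQ k))
  rw [← compl_inj_iff, ← h1, ← h2]
  exact Set.image_congr fun x hx => by rw [hPQ hx]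

lemma det_fderiv_eq_zero_of_norm_eq_one {V : Type*} [NormedAddCommGroup V]
    [InnerProductSpace ℝ V] [FiniteDimensional ℝ V] {P : V → V} {x : V}
    (hP : ∀ᶠ y in nhds x, ‖P y‖ = 1) (hd : DifferentiableAt ℝ P x) :
    (fderiv ℝ P x).det = 0 := by
  by_contra hne
  have hsurj : Surjective (fderiv ℝ P x) := by
    have := LinearMap.isUnit_iff_isUnit_det (fderiv ℝ P x : V →ₗ[ℝ] V) |>.2
      (isUnit_iff_ne_zero.2 hne)
    exact ((Module.End.isUnit_iff _).1 this).2
  obtain ⟨v, hv⟩ := hsurj (P x)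
  have h1 : HasFDerivAt (fun y => ‖P y‖ ^ 2) (0 : V →L[ℝ] ℝ) x :=
    (hasFDerivAt_const (1 : ℝ) x).congr_of_eventuallyEq (hP.mono fun y hy => by simp [hy])
  have h2 := congrArg (· v) (hd.hasFDerivAt.norm_sq.unique h1)
  have hx : ‖P x‖ = 1 := hP.self_of_nhds
  simp [hv, hx] at h2

lemma lipschitzWith_inv_max_norm_smul {W : Type*} [NormedAddCommGroup W] [NormedSpace ℝ W]
    {ε : ℝ≥0} (hε : 0 < ε) :
    LipschitzWith (2 / ε) fun y : W => (max ‖y‖ ε)⁻¹ • y := by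
  refine LipschitzWith.of_dist_le_mul fun y z => ?_
  have hε' : (0 : ℝ) < ε := hε
  set a := max ‖y‖ (ε : ℝ) with ha
  set b := max ‖z‖ (ε : ℝ) with hb
  have ha0 : (ε : ℝ) ≤ a := le_max_right _ _
  have hb0 : (ε : ℝ) ≤ b := le_max_right _ _
  have hab : |b - a| ≤ ‖y - z‖ :=
    (abs_max_sub_max_le_abs _ _ _).trans ((abs_norm_sub_norm_le z y).trans_eq (norm_sub_rev z y))
  have hapos := hε'.trans_le ha0
  have hbpos := hε'.trans_le hb0
  have hsplit : a⁻¹ • y - b⁻¹ • z = a⁻¹ • (y - z) + (a⁻¹ * (b - a) * b⁻¹) • z := by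
    have : a⁻¹ * (b - a) * b⁻¹ = a⁻¹ - b⁻¹ := by field_simp
    rw [this, smul_sub, sub_smul]; abel
  rw [dist_eq_norm, dist_eq_norm, hsplit]
  have hz : b⁻¹ * ‖z‖ ≤ 1 := by
    rw [inv_mul_le_iff₀ hbpos, mul_one]; exact le_max_left _ _
  have hinv : a⁻¹ ≤ (ε : ℝ)⁻¹ := inv_anti₀ hε' ha0
  calc ‖a⁻¹ • (y - z) + (a⁻¹ * (b - a) * b⁻¹) • z‖
      ≤ a⁻¹ * ‖y - z‖ + a⁻¹ * |b - a| * (b⁻¹ * ‖z‖) := by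
        refine (norm_add_le _ _).trans_eq ?_
        rw [norm_smul, norm_smul, norm_mul, norm_mul, Real.norm_eq_abs, Real.norm_eq_abs,
          Real.norm_eq_abs, abs_of_pos (inv_pos.2 hapos), abs_of_pos (inv_pos.2 hbpos)]
        ring
    _ ≤ (ε : ℝ)⁻¹ * ‖y - z‖ + (ε : ℝ)⁻¹ * ‖y - z‖ * 1 := by gcongr
    _ = ((2 / ε : ℝ≥0) : ℝ) * ‖y - z‖ := by push_cast; ring

lemma LipschitzWith.exists_isFixedPt_of_hasCompactSupport {V : Type*} [NormedAddCommGroup V]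
    [InnerProductSpace ℝ V] [FiniteDimensional ℝ V] {g : V → V} {K : ℝ≥0}
    (hg : LipschitzWith K g) (hgc : HasCompactSupport g) : ∃ x, IsFixedPt g x := by
  borelize V
  let μ : Measure V := Measure.addHaar
  by_contra! hno
  set F : V → V := fun x => x - g x
  have hF : LipschitzWith (1 + K) F := LipschitzWith.id.sub hg
  have hF0 : ∀ x, F x ≠ 0 := fun x hx => hno x (sub_eq_zero.1 hx).symm
  obtain ⟨R, hR0, hR⟩ := hgc.isCompact.isBounded.subset_ball_lt 0 0
  have hFid : Set.EqOn F id (ball (0 : V) R)ᶜ := fun x hx => by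
    have : g x = 0 := image_eq_zero_of_notMem_tsupport fun h => hx (hR h)
    simp [F, this]
  have hFtop : Filter.Tendsto (fun x => ‖F x‖) (Filter.cocompact V) Filter.atTop := by
    refine (tendsto_norm_cocompact_atTop (E := V)).congr' ?_
    filter_upwards [(isCompact_closedBall (0 : V) R).compl_mem_cocompact] with x hx
    rw [hFid fun h => hx (ball_subset_closedBall h), id]
  obtain ⟨x₀, hx₀⟩ := hF.continuous.norm.exists_forall_le hFtop
  set ε : ℝ≥0 := min ‖F x₀‖₊ (Real.toNNReal R) with hεdef
  have hε : 0 < ε := lt_min (nnnorm_pos.2 (hF0 x₀)) (Real.toNNReal_pos.2 hR0)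
  have hεR : (ε : ℝ) ≤ R := by
    rw [← Real.coe_toNNReal R hR0.le]; exact NNReal.coe_le_coe.2 (min_le_right _ _)
  have hε' : (0 : ℝ) < ε := hε
  have hFε : ∀ x, (ε : ℝ) ≤ ‖F x‖ := fun x =>
    (show (ε : ℝ) ≤ ‖F x₀‖ from min_le_left ‖F x₀‖₊ _).trans (hx₀ x)
  set h : V → V := fun y => (max ‖y‖ ε)⁻¹ • y with hh
  have hhL : LipschitzWith (2 / ε) h := lipschitzWith_inv_max_norm_smul hε
  have hh1 : ∀ y, (ε : ℝ) ≤ ‖y‖ → ‖h y‖ = 1 := fun y hy => by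
    have : ‖y‖ ≠ 0 := (hε'.trans_le hy).ne'
    simp [hh, max_eq_left hy, norm_smul, this]
  have key := setIntegral_det_fderiv_eq_of_eqOn_compl μ (hhL.comp hF) hhL
    (measurableSet_ball (x := (0 : V)) (ε := R)) isBounded_ball fun x hx => by
      rw [comp_apply, hFid hx, id]
  have hleft : ∫ x in ball (0 : V) R, (fderiv ℝ (h ∘ F) x).det ∂μ = 0 := by
    refine integral_eq_zero_of_ae (ae_restrict_of_ae ?_)
    filter_upwards [(hhL.comp hF).ae_differentiableAt (μ := μ)] with x hx
    exact det_fderiv_eq_zero_of_norm_eq_one (.of_forall fun y => hh1 _ (hFε y)) hx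
  have hright : ∫ x in ball (0 : V) R, (fderiv ℝ h x).det ∂μ =
      ∫ x in ball (0 : V) ε, ((ε : ℝ)⁻¹) ^ finrank ℝ V ∂μ := by
    have hball : ball (0 : V) ε ⊆ ball (0 : V) R := ball_subset_ball hεR
    rw [← integral_indicator measurableSet_ball, ← integral_indicator measurableSet_ball]
    refine integral_congr_ae ?_
    filter_upwards [hhL.ae_differentiableAt (μ := μ),
      measure_eq_zero_iff_ae_notMem.1 (Measure.addHaar_sphere_of_ne_zero μ (0 : V) hε'.ne')]
      with x hx hxs
    by_cases hxε : ‖x‖ < ε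
    · have hxm : x ∈ ball (0 : V) ε := by simpa using hxε
      rw [Set.indicator_of_mem (hball hxm), Set.indicator_of_mem hxm]
      have heq : h =ᶠ[nhds x] fun y => (ε : ℝ)⁻¹ • y := by
        filter_upwards [isOpen_ball.mem_nhds hxm] with y hy
        have : ‖y‖ < ε := by simpa using hy
        simp [hh, max_eq_right this.le]
      have : HasFDerivAt (fun y : V => (ε : ℝ)⁻¹ • y) ((ε : ℝ)⁻¹ • ContinuousLinearMap.id ℝ V) x :=
        (hasFDerivAt_id x).const_smul _
      rw [heq.fderiv_eq, this.fderiv]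
      simp [ContinuousLinearMap.det]
    · have hlt : (ε : ℝ) < ‖x‖ := lt_of_le_of_ne (not_lt.1 hxε) fun h => hxs (by simp [h])
      have hdet : (fderiv ℝ h x).det = 0 := by
        refine det_fderiv_eq_zero_of_norm_eq_one ?_ hx
        filter_upwards [continuous_norm.continuousAt.eventually (lt_mem_nhds hlt)] with y hy
        exact hh1 y hy.le
      rw [Set.indicator_apply, hdet, ite_self, Set.indicator_of_notMem (by simpa using hxε)]
  rw [hleft, hright, setIntegral_const, smul_eq_mul] at key
  have hvol : 0 < μ.real (ball (0 : V) ε) :=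
    ENNReal.toReal_pos (measure_ball_pos μ 0 hε').ne' measure_ball_lt_top.ne
  exact (mul_pos hvol (pow_pos (inv_pos.2 hε') _)).ne key

lemma Continuous.exists_isFixedPt_of_isBounded_range {V : Type*} [NormedAddCommGroup V]
    [InnerProductSpace ℝ V] [FiniteDimensional ℝ V] {f : V → V} (hf : Continuous f)
    (hb : Bornology.IsBounded (Set.range f)) : ∃ x, IsFixedPt f x := by
  obtain ⟨R, hR0, hR⟩ := hb.subset_closedBall_lt 0 0
  have hfR : ∀ x, ‖f x‖ ≤ R := fun x => by simpa using hR ⟨x, rfl⟩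
  set θ : V → ℝ := fun x => max 0 (min 1 (R + 1 - ‖x‖)) with hθ
  have hθ0 : ∀ x, 0 ≤ θ x := fun x => le_max_left _ _
  have hθ1 : ∀ x, θ x ≤ 1 := fun x => max_le zero_le_one (min_le_left _ _)
  have hθc : Continuous θ := by fun_prop
  set f₀ : V → V := fun x => θ x • f x with hf₀
  have hf₀c : Continuous f₀ := hθc.smul hf
  have hf₀z : ∀ x, R + 1 ≤ ‖x‖ → f₀ x = 0 := fun x hx => by
    have : θ x = 0 := max_eq_left ((min_le_right _ _).trans (by linarith))
    simp [hf₀, this]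
  have hf₀R : ∀ x, ‖f₀ x‖ ≤ R := fun x => by
    rw [hf₀]; dsimp only; rw [norm_smul, Real.norm_of_nonneg (hθ0 x)]
    exact (mul_le_of_le_one_left (norm_nonneg _) (hθ1 x)).trans (hfR x)
  have hsupp : HasCompactSupport f₀ :=
    HasCompactSupport.intro (isCompact_closedBall (0 : V) (R + 1))
    fun x hx => hf₀z x (by simpa using (not_le.1 fun h => hx (by simpa using h)).le)
  have happrox : ∀ δ > 0, ∃ x, ‖x - f₀ x‖ ≤ δ := by
    intro δ hδ
    obtain ⟨η, hη, hηf⟩ := Metric.uniformContinuous_iff.1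
      (hsupp.uniformContinuous_of_continuous hf₀c) δ hδ
    obtain ⟨g, hg, hgf⟩ := hf₀c.exists_contDiff_dist_le_of_forall_mem_ball_dist_le
      (lt_min hη one_pos)
    have hgs : HasCompactSupport g := by
      refine HasCompactSupport.intro (isCompact_closedBall (0 : V) (R + 2)) fun x hx => ?_
      have hx : R + 2 < ‖x‖ := by simpa using hx
      have h0 : f₀ x = 0 := hf₀z x (by linarith)
      have := hgf x 0 fun y hy => by
        have hy1 : dist y x < 1 := (mem_ball.1 hy).trans_le (min_le_right _ _)
        have : ‖x‖ ≤ ‖y‖ + dist y x := by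
          rw [dist_comm, dist_eq_norm]; linarith [norm_sub_norm_le x y]
        rw [h0, hf₀z y (by linarith), dist_self]
      simpa [h0] using this
    obtain ⟨K, hK⟩ := hg.lipschitzWith_of_hasCompactSupport hgs (by simp)
    obtain ⟨x, hx⟩ := hK.exists_isFixedPt_of_hasCompactSupport hgs
    refine ⟨x, ?_⟩
    have := hgf x δ fun y hy => (hηf ((mem_ball.1 hy).trans_le (min_le_left _ _))).le
    rwa [hx, dist_eq_norm] at this
  have htop : Filter.Tendsto (fun x => ‖x - f₀ x‖) (Filter.cocompact V) Filter.atTop := by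
    refine (tendsto_norm_cocompact_atTop (E := V)).congr' ?_
    filter_upwards [(isCompact_closedBall (0 : V) (R + 1)).compl_mem_cocompact] with x hx
    rw [hf₀z x (by simpa using (not_le.1 fun h => hx (by simpa using h)).le), sub_zero]
  obtain ⟨x, hx⟩ := (continuous_id.sub hf₀c).norm.exists_forall_le htop
  have hfix : f₀ x = x := by
    refine (sub_eq_zero.1 (norm_le_zero_iff.1 (le_of_forall_pos_le_add fun δ hδ => ?_))).symm
    obtain ⟨y, hy⟩ := happrox δ hδ
    rw [zero_add]
    exact (hx y).trans hy
  have hxR : ‖x‖ ≤ R := hfix ▸ hf₀R x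
  have hθx : θ x = 1 := by
    have : min 1 (R + 1 - ‖x‖) = 1 := min_eq_left (by linarith)
    rw [hθ]; dsimp only; rw [this]; simp
  exact ⟨x, by rw [hf₀] at hfix; dsimp only at hfix; rwa [hθx, one_smul] at hfix⟩

lemma exists_continuous_retraction_of_convex {V : Type*} [NormedAddCommGroup V]
    [InnerProductSpace ℝ V] [CompleteSpace V] {K : Set V} (hne : K.Nonempty) (hK : IsClosed K)
    (hc : Convex ℝ K) : ∃ p : V → V, Continuous p ∧ (∀ x, p x ∈ K) ∧ ∀ x ∈ K, p x = x := by
  choose p hpK hp using exists_norm_eq_iInf_of_complete_convex hne hK.isComplete hc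
  have hvar : ∀ u, ∀ w ∈ K, inner ℝ (u - p u) (w - p u) ≤ 0 := fun u =>
    (norm_eq_iInf_iff_real_inner_le_zero hc (hpK u)).1 (hp u)
  refine ⟨p, ?_, hpK, fun x hx => ?_⟩
  · refine (LipschitzWith.of_dist_le_mul (K := 1) fun u v => ?_).continuous
    rw [NNReal.coe_one, one_mul, dist_eq_norm, dist_eq_norm]
    have h1 := hvar u _ (hpK v)
    have h2 := hvar v _ (hpK u)
    have h3 : ‖p u - p v‖ ^ 2 ≤ inner ℝ (u - v) (p u - p v) := by
      rw [← real_inner_self_eq_norm_sq]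
      have : inner ℝ (u - v) (p u - p v) - inner ℝ (p u - p v) (p u - p v) =
          -(inner ℝ (u - p u) (p v - p u)) - inner ℝ (v - p v) (p u - p v) := by
        simp only [inner_sub_left, inner_sub_right]; ring
      linarith
    have h4 := real_inner_le_norm (u - v) (p u - p v)
    rcases (norm_nonneg (p u - p v)).eq_or_lt with h | h
    · rw [← h]; exact norm_nonneg _
    · nlinarith
  · have := hvar x x hx
    rw [real_inner_self_eq_norm_sq] at this
    have : ‖x - p x‖ = 0 := by nlinarith [norm_nonneg (x - p x)]
    exact (sub_eq_zero.1 (norm_eq_zero.1 this)).symm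

/-- **Brouwer's fixed point theorem** for compact convex subsets of finite-dimensional spaces. -/
theorem exists_isFixedPt_of_isCompact_convex {W : Type*} [NormedAddCommGroup W] [NormedSpace ℝ W]
    [FiniteDimensional ℝ W] {K : Set W} (hne : K.Nonempty) (hK : IsCompact K) (hc : Convex ℝ K)
    {f : W → W} (hf : ContinuousOn f K) (hfK : Set.MapsTo f K K) : ∃ x ∈ K, IsFixedPt f x := by
  let e : W ≃L[ℝ] EuclideanSpace ℝ (Fin (finrank ℝ W)) := toEuclidean
  obtain ⟨p, hpc, hpK, hp⟩ := exists_continuous_retraction_of_convex (hne.image e)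
    (hK.image e.continuous).isClosed (hc.linear_image e.toLinearMap)
  have hsymm : ∀ x, e.symm (p x) ∈ K := fun x => by
    obtain ⟨y, hy, hxy⟩ := hpK x
    rw [← hxy]; simpa using hy
  have hcont : Continuous fun x => e (f (e.symm (p x))) :=
    e.continuous.comp (hf.comp_continuous (e.symm.continuous.comp hpc) hsymm)
  obtain ⟨x, hx⟩ := hcont.exists_isFixedPt_of_isBounded_range
    ((hK.image e.continuous).isBounded.subset (by
      rintro _ ⟨x, rfl⟩
      exact Set.mem_image_of_mem _ (hfK (hsymm x))))
  have hxK : x ∈ e '' K := by rw [← hx]; exact Set.mem_image_of_mem _ (hfK (hsymm x))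
  obtain ⟨y, hy, rfl⟩ := hxK
  refine ⟨y, hy, ?_⟩
  have h1 : e (f (e.symm (p (e y)))) = e y := hx
  rw [hp _ (Set.mem_image_of_mem _ hy), e.symm_apply_apply] at h1
  exact e.injective h1

end Brouwer

lemma isCompact_convexHull_of_finiteDimensional {V : Type*} [AddCommGroup V] [Module ℝ V]
    [TopologicalSpace V] [IsTopologicalAddGroup V] [ContinuousSMul ℝ V] [FiniteDimensional ℝ V]
    {s : Set V} (hs : IsCompact s) : IsCompact (convexHull ℝ s) := by
  have heq : convexHull ℝ s = ⋃ k ∈ range (Module.finrank ℝ V + 2),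
      (fun p : (Fin k → ℝ) × (Fin k → V) => ∑ i, p.1 i • p.2 i) ''
        (stdSimplex ℝ (Fin k) ×ˢ Set.univ.pi fun _ => s) := by
    refine Set.Subset.antisymm (fun x hx => ?_) (Set.iUnion₂_subset fun k _ => ?_)
    · obtain ⟨ι, _, z, w, hz, hind, hw, hw1, rfl⟩ := eq_pos_convex_span_of_mem_convexHull hx
      have hcard : Fintype.card ι ≤ Module.finrank ℝ V + 1 := hind.card_le_finrank_succ.trans
        (Nat.succ_le_succ (Submodule.finrank_le _))
      let e := Fintype.equivFin ι
      refine Set.mem_biUnion (Finset.mem_coe.2 (mem_range.2 (Nat.lt_succ_of_le hcard)))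
        ⟨(w ∘ e.symm, z ∘ e.symm), ⟨⟨fun i => (hw _).le, ?_⟩, fun i _ => hz ⟨_, rfl⟩⟩, ?_⟩
      · rw [← hw1]; exact e.symm.sum_comp w
      · exact e.symm.sum_comp fun i => w i • z i
    · rintro _ ⟨⟨w, z⟩, ⟨hw, hz⟩, rfl⟩
      exact (convex_convexHull ℝ s).sum_mem (fun i _ => hw.1 i) hw.2
        fun i _ => subset_convexHull ℝ s (hz i trivial)
  rw [heq]
  exact (range _).isCompact_biUnion fun k _ =>
    ((isCompact_stdSimplex ℝ _).prod (isCompact_univ_pi fun _ => hs)).image (by fun_prop)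

section Payoffs

open Function

variable {I : Type*} [Fintype I] {C : I → Type*} [∀ i, Fintype (C i)]

lemma sum_prod_apply_eq_one {ρ : ∀ i, C i → ℝ} (hρ : ∀ i, ∑ c, ρ i c = 1) :
    ∑ s : ∀ i, C i, ∏ i, ρ i (s i) = 1 := by
  rw [← Fintype.piFinset_univ, ← Finset.prod_univ_sum]
  simp [hρ]

/-- Conditioning on the `i`-th coordinate under a product distribution. -/
lemma sum_sum_update_eq {ρ : ∀ i, C i → ℝ} {i : I} (hρ : ∑ c, ρ i c = 1)
    (F : C i → (∀ j, C j) → ℝ) :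
    ∑ c, ∑ s : ∀ j, C j, ρ i c * ((∏ j, ρ j (s j)) * F c (update s i c)) =
      ∑ s : ∀ j, C j, (∏ j, ρ j (s j)) * F (s i) s := by
  have hinv : Involutive fun p : C i × (∀ j, C j) => (p.2 i, update p.2 i p.1) := by
    rintro ⟨c, s⟩
    simp
  have hw : ∀ (c : C i) (s : ∀ j, C j),
      ρ i (s i) * ∏ j, ρ j (update s i c j) = ρ i c * ∏ j, ρ j (s j) := by
    intro c s
    rw [← mul_prod_erase univ (fun j => ρ j (update s i c j)) (mem_univ i),
      ← mul_prod_erase univ (fun j => ρ j (s j)) (mem_univ i), update_self,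
      prod_congr rfl fun j hj => by rw [update_of_ne (ne_of_mem_erase hj)]]
    ring
  rw [← Fintype.sum_prod_type' fun c (s : ∀ j, C j) =>
    ρ i c * ((∏ j, ρ j (s j)) * F c (update s i c)),
    ← Equiv.sum_comp hinv.toPerm, Fintype.sum_prod_type]
  simp only [Involutive.coe_toPerm, update_idem, update_eq_self, ← mul_assoc, hw]
  simp only [mul_assoc, ← mul_sum]
  rw [← sum_mul, hρ, one_mul]

/-- Expected payoff to player `i` from playing `c` when all players otherwise follow `ρ`. -/
noncomputable def deviationPayoff (v : (∀ j, C j) → ℝ) (i : I) (c : C i) (ρ : ∀ j, C j → ℝ) : ℝ :=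
  ∑ s : ∀ j, C j, (∏ j, ρ j (s j)) * v (update s i c)

/-- Expected value of `v` under the product distribution of `ρ`. -/
noncomputable def expectedPayoff (v : (∀ j, C j) → ℝ) (ρ : ∀ j, C j → ℝ) : ℝ :=
  ∑ s : ∀ j, C j, (∏ j, ρ j (s j)) * v s

lemma sum_mul_deviationPayoff {ρ : ∀ i, C i → ℝ} {i : I} (hρ : ∑ c, ρ i c = 1)
    (v : (∀ j, C j) → ℝ) :
    ∑ c, ρ i c * deviationPayoff v i c ρ = expectedPayoff v ρ := by
  simp only [deviationPayoff, mul_sum]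
  exact sum_sum_update_eq hρ fun _ s => v s

/-- The gain of player `i` from deviating to `c`, truncated at zero. -/
noncomputable def deviationGain (u : ∀ i : I, (∀ j, C j) → ℝ) (ρ : ∀ j, C j → ℝ) (i : I)
    (c : C i) : ℝ :=
  max 0 (deviationPayoff (u i) i c ρ - expectedPayoff (u i) ρ)

/-- Nash's map, whose fixed points are the Nash equilibria. -/
noncomputable def nashMap (u : ∀ i : I, (∀ j, C j) → ℝ) (ρ : ∀ j, C j → ℝ) : ∀ j, C j → ℝ :=
  fun i c => (ρ i c + deviationGain u ρ i c) / (1 + ∑ d, deviationGain u ρ i d)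

variable (u : ∀ i : I, (∀ j, C j) → ℝ)

lemma deviationGain_nonneg (ρ : ∀ j, C j → ℝ) (i : I) (c : C i) : 0 ≤ deviationGain u ρ i c :=
  le_max_left _ _

lemma one_add_sum_deviationGain_pos (ρ : ∀ j, C j → ℝ) (i : I) :
    0 < 1 + ∑ d, deviationGain u ρ i d :=
  add_pos_of_pos_of_nonneg one_pos (sum_nonneg fun d _ => deviationGain_nonneg u ρ i d)

lemma continuous_nashMap : Continuous (nashMap u) := by
  have hg : ∀ i c, Continuous fun ρ : ∀ j, C j → ℝ => deviationGain u ρ i c := fun i c => by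
    unfold deviationGain deviationPayoff expectedPayoff
    fun_prop
  refine continuous_pi fun i => continuous_pi fun c => Continuous.div ?_ ?_ fun ρ =>
    (one_add_sum_deviationGain_pos u ρ i).ne'
  · have := hg i c
    fun_prop
  · exact continuous_const.add (continuous_finsetSum _ fun d _ => hg i d)

lemma nashMap_mem_stdSimplex {ρ : ∀ j, C j → ℝ} {i : I} (hρ : ρ i ∈ stdSimplex ℝ (C i)) :
    nashMap u ρ i ∈ stdSimplex ℝ (C i) := by
  have hpos := one_add_sum_deviationGain_pos u ρ i
  refine ⟨fun c => div_nonneg (add_nonneg (hρ.1 c) (deviationGain_nonneg u ρ i c)) hpos.le, ?_⟩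
  simp only [nashMap]
  rw [← sum_div, sum_add_distrib, hρ.2, div_self hpos.ne']

lemma mul_deviationPayoff_sub_nonpos_of_nashMap_eq {ρ : ∀ j, C j → ℝ}
    (hρ : ∀ i, ρ i ∈ stdSimplex ℝ (C i)) (hfix : nashMap u ρ = ρ) (i : I) (c d : C i) :
    ρ i c * (deviationPayoff (u i) i d ρ - deviationPayoff (u i) i c ρ) ≤ 0 := by
  set S := ∑ d, deviationGain u ρ i d with hS
  have hgain : ∀ c, deviationGain u ρ i c = ρ i c * S := fun c => by
    have h := congrFun (congrFun hfix i) c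
    rw [nashMap, div_eq_iff (one_add_sum_deviationGain_pos u ρ i).ne', ← hS] at h
    linarith
  have hzero : ∑ c, ρ i c * (deviationPayoff (u i) i c ρ - expectedPayoff (u i) ρ) = 0 := by
    simp only [mul_sub, sum_sub_distrib, sum_mul_deviationPayoff (hρ i).2, ← sum_mul, (hρ i).2,
      one_mul, sub_self]
  have hS0 : S = 0 := by
    by_contra hne
    have hSpos : 0 < S :=
      lt_of_le_of_ne (sum_nonneg fun d _ => deviationGain_nonneg u ρ i d) (Ne.symm hne)
    have hnn : ∀ c, 0 ≤ ρ i c * (deviationPayoff (u i) i c ρ - expectedPayoff (u i) ρ) := by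
      intro c
      rcases ((hρ i).1 c).eq_or_lt with h0 | hpos
      · rw [← h0, zero_mul]
      · have h1 : 0 < deviationGain u ρ i c := by rw [hgain]; exact mul_pos hpos hSpos
        exact mul_nonneg hpos.le ((lt_max_iff.1 h1).resolve_left (lt_irrefl _)).le
    have hall := (sum_eq_zero_iff_of_nonneg fun c _ => hnn c).1 hzero
    refine one_ne_zero ((hρ i).2.symm.trans (sum_eq_zero fun c _ => ?_))
    rcases mul_eq_zero.1 (hall c (mem_univ c)) with h | h
    · exact h
    · have h1 := hgain c
      rw [deviationGain, h, max_self] at h1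
      exact (mul_eq_zero.1 h1.symm).resolve_right hne
  have hle : ∀ c, deviationPayoff (u i) i c ρ ≤ expectedPayoff (u i) ρ := fun c => by
    have h1 := hgain c
    rw [hS0, mul_zero, deviationGain] at h1
    linarith [le_max_right 0 (deviationPayoff (u i) i c ρ - expectedPayoff (u i) ρ)]
  have hall := (sum_eq_zero_iff_of_nonpos fun c _ =>
    mul_nonpos_of_nonneg_of_nonpos ((hρ i).1 c) (sub_nonpos.2 (hle c))).1 hzero c (mem_univ c)
  have := mul_le_mul_of_nonneg_left (hle d) ((hρ i).1 c)
  linarith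

end Payoffs

section Symmetry

open Function

namespace GameAction

variable {G : Type*} [Group G] {I : Type*} {C : I → Type*} {u : ∀ i : I, (∀ j, C j) → ℝ}
  (A : GameAction G C u)

/-- The permutation of the players given by a group element. -/
def playerEquiv (g : G) : I ≃ I where
  toFun := A.actI g
  invFun := A.actI g⁻¹
  left_inv i := by rw [← A.actI_mul, inv_mul_cancel, A.actI_one]
  right_inv i := by rw [← A.actI_mul, mul_inv_cancel, A.actI_one]

/-- The permutation of the strategy profiles given by a group element. -/
def profileEquiv (g : G) : (∀ j, C j) ≃ ∀ j, C j where
  toFun := A.actS g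
  invFun := A.actS g⁻¹
  left_inv s := by rw [← A.actS_mul, inv_mul_cancel, A.actS_one]
  right_inv s := by rw [← A.actS_mul, mul_inv_cancel, A.actS_one]

lemma exists_strategyEquiv [∀ j, Nonempty (C j)] (g : G) (i : I) :
    ∃ e : C i ≃ C (A.actI g i), ∀ s, A.actS g s (A.actI g i) = e (s i) := by
  let f : C i → C (A.actI g i) := fun c =>
    A.actS g (update (fun _ => Classical.arbitrary _) i c) (A.actI g i)
  have hf : ∀ s, A.actS g s (A.actI g i) = f (s i) := fun s =>
    A.diagonal g _ _ i (update_self i (s i) _).symm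
  have hinj : Injective f := fun c d hcd => by
    have h := A.diagonal g⁻¹ _ _ _ hcd
    rw [← A.actS_mul, ← A.actS_mul, inv_mul_cancel, A.actS_one, A.actS_one, ← A.actI_mul,
      inv_mul_cancel, A.actI_one] at h
    simpa using h
  have hsurj : Surjective f := fun c => by
    refine ⟨A.actS g⁻¹ (update (fun _ => Classical.arbitrary _) (A.actI g i) c) i, ?_⟩
    rw [← hf, ← A.actS_mul, mul_inv_cancel, A.actS_one, update_self]
  exact ⟨Equiv.ofBijective f ⟨hinj, hsurj⟩, hf⟩

/-- Strategy tuples whose product distribution is invariant because each `g` carries the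
distribution of player `i` to that of player `g·i`. -/
def invTuples : Set (∀ i, C i → ℝ) :=
  {ρ | ∀ g i s, ρ (A.actI g i) (A.actS g s (A.actI g i)) = ρ i (s i)}

lemma update_actS (g : G) (i : I) (s t : ∀ j, C j) :
    update (A.actS g s) (A.actI g i) (A.actS g t (A.actI g i)) =
      A.actS g (update s i (t i)) := by
  refine funext fun k => ?_
  obtain ⟨k, rfl⟩ := (A.playerEquiv g).surjective k
  change update _ _ _ (A.actI g k) = A.actS g _ (A.actI g k)
  rcases eq_or_ne k i with rfl | hk
  · rw [update_self]
    exact A.diagonal _ _ _ _ (update_self _ _ _).symm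
  · have hgk : A.actI g k ≠ A.actI g i := (A.playerEquiv g).injective.ne hk
    rw [update_of_ne hgk]
    exact A.diagonal _ _ _ _ (update_of_ne hk _ _).symm

lemma isClosed_invTuples : IsClosed A.invTuples := by
  simp only [invTuples, Set.ofPred_forall]
  exact isClosed_iInter fun g => isClosed_iInter fun i => isClosed_iInter fun s =>
    isClosed_eq (by fun_prop) (by fun_prop)

lemma convex_invTuples : Convex ℝ A.invTuples := by
  intro ρ hρ τ hτ a b _ _ _ g i s
  simp only [Pi.add_apply, Pi.smul_apply, hρ g i s, hτ g i s]

variable [Fintype I]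

variable {A} in
lemma prod_actS {ρ : ∀ i, C i → ℝ} (hρ : ρ ∈ A.invTuples) (g : G) (s : ∀ j, C j) :
    ∏ i, ρ i (A.actS g s i) = ∏ i, ρ i (s i) := by
  rw [← Equiv.prod_comp (A.playerEquiv g)]
  exact prod_congr rfl fun i _ => hρ g i s

variable [∀ i, Fintype (C i)]

variable {A} in
lemma expectedPayoff_actI {ρ : ∀ i, C i → ℝ} (hρ : ρ ∈ A.invTuples) (g : G) (i : I) :
    expectedPayoff (u (A.actI g i)) ρ = expectedPayoff (u i) ρ := by
  rw [expectedPayoff, ← Equiv.sum_comp (A.profileEquiv g)]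
  refine sum_congr rfl fun s _ => ?_
  change (∏ j, ρ j (A.actS g s j)) * u (A.actI g i) (A.actS g s) = _
  rw [prod_actS hρ, A.utility_inv]

variable {A} in
lemma deviationPayoff_actI {ρ : ∀ i, C i → ℝ} (hρ : ρ ∈ A.invTuples) (g : G) (i : I)
    (t : ∀ j, C j) :
    deviationPayoff (u (A.actI g i)) (A.actI g i) (A.actS g t (A.actI g i)) ρ =
      deviationPayoff (u i) i (t i) ρ := by
  rw [deviationPayoff, ← Equiv.sum_comp (A.profileEquiv g)]
  refine sum_congr rfl fun s _ => ?_
  change (∏ j, ρ j (A.actS g s j)) * u (A.actI g i) (update (A.actS g s) _ _) = _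
  rw [prod_actS hρ, update_actS, A.utility_inv]

variable {A} in
lemma nashMap_mem_invTuples {ρ : ∀ i, C i → ℝ} (hρ : ρ ∈ A.invTuples) :
    nashMap u ρ ∈ A.invTuples := by
  intro g i s
  have hgain : ∀ t : ∀ j, C j,
      deviationGain u ρ (A.actI g i) (A.actS g t (A.actI g i)) = deviationGain u ρ i (t i) :=
    fun t => by
      rw [deviationGain, deviationPayoff_actI hρ, expectedPayoff_actI hρ, deviationGain]
  have : ∀ j, Nonempty (C j) := fun j => ⟨s j⟩
  obtain ⟨e, he⟩ := A.exists_strategyEquiv g i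
  rw [nashMap, nashMap, hgain, hρ, ← Equiv.sum_comp e]
  congr 2
  refine sum_congr rfl fun c _ => ?_
  have h := hgain (update s i c)
  rwa [he, update_self] at h

/-- A finite game has a Nash equilibrium invariant under a given group of symmetries. -/
theorem exists_invariant_nash [∀ i, Nonempty (C i)] :
    ∃ ρ ∈ A.invTuples, (∀ i, ρ i ∈ stdSimplex ℝ (C i)) ∧
      ∀ i c d, ρ i c * (deviationPayoff (u i) i d ρ - deviationPayoff (u i) i c ρ) ≤ 0 := by
  let S : Set (∀ i, C i → ℝ) := Set.univ.pi fun i => stdSimplex ℝ (C i)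
  have hne : (S ∩ A.invTuples).Nonempty := by
    refine ⟨fun i _ => (Fintype.card (C i) : ℝ)⁻¹, fun i _ => ⟨fun _ => by positivity, ?_⟩,
      fun g i s => ?_⟩
    · simp
    · obtain ⟨e, -⟩ := A.exists_strategyEquiv g i
      simp only [Fintype.card_congr e]
  have hcpt : IsCompact (S ∩ A.invTuples) :=
    (isCompact_univ_pi fun i => isCompact_stdSimplex ℝ (C i)).inter_right A.isClosed_invTuples
  have hconv : Convex ℝ (S ∩ A.invTuples) :=
    (convex_pi fun i _ => convex_stdSimplex ℝ (C i)).inter A.convex_invTuples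
  obtain ⟨ρ, ⟨hρS, hρ⟩, hfix⟩ := exists_isFixedPt_of_isCompact_convex hne hcpt hconv
    (continuous_nashMap u).continuousOn fun ρ hρ =>
      ⟨fun i hi => nashMap_mem_stdSimplex u (hρ.1 i hi), nashMap_mem_invTuples hρ.2⟩
  have hρS' : ∀ i, ρ i ∈ stdSimplex ℝ (C i) := fun i => hρS i trivial
  exact ⟨ρ, hρ, hρS', mul_deviationPayoff_sub_nonpos_of_nashMap_eq u hρS' hfix⟩

end GameAction

end Symmetry

section Powers

open Function

variable {I : Type*} [Fintype I] {C : I → Type*} [∀ i, Fintype (C i)]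

/-- A profile of a power of a game, read copy by copy. -/
def copiesEquiv (C : I → Type*) (m : ℕ) : (∀ i, Fin m → C i) ≃ (Fin m → ∀ i, C i) :=
  Equiv.piComm fun i (_ : Fin m) => C i

lemma sum_prod_copies_eq_prod_sum {m : ℕ} (f : Fin m → (∀ i, C i) → ℝ) :
    ∑ s : ∀ i, Fin m → C i, ∏ j, f j (fun i => s i j) = ∏ j, ∑ p, f j p := by
  rw [Finset.prod_univ_sum, Fintype.piFinset_univ, ← Equiv.sum_comp (copiesEquiv C m)]
  rfl

/-- The power of the product distribution of a Nash equilibrium is a correlated equilibrium of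
the contracted power of the game. -/
lemma prod_prod_mem_ceTen {u : ∀ i : I, (∀ j, C j) → ℝ} {ρ : ∀ i, C i → ℝ}
    (hρ : ∀ i, ρ i ∈ stdSimplex ℝ (C i))
    (hnash : ∀ i c d,
      ρ i c * (deviationPayoff (u i) i d ρ - deviationPayoff (u i) i c ρ) ≤ 0) (m : ℕ) :
    (fun s : ∀ i, Fin m → C i => ∏ j, ∏ i, ρ i (s i j)) ∈ ceTen u m := by
  have hnn : ∀ p : ∀ i, C i, 0 ≤ ∏ i, ρ i (p i) := fun p => prod_nonneg fun i _ => (hρ i).1 _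
  refine ⟨⟨fun s => prod_nonneg fun j _ => hnn fun i => s i j, ?_⟩, fun i r t => ?_⟩
  · rw [sum_prod_copies_eq_prod_sum fun _ p => ∏ i, ρ i (p i),
      sum_prod_apply_eq_one fun i => (hρ i).2, prod_const_one]
  let D : Fin m → (∀ i, C i) → ℝ := fun j p => u i (update p i (t j)) - u i p
  let w : Fin m → (∀ i, C i) → ℝ := fun j p => if p i = r j then ∏ k, ρ k (p k) else 0
  have hterm : ∀ s : ∀ k, Fin m → C k,
      (if s i = r then (uTen u m i (update s i t) - uTen u m i s) * ∏ j, ∏ k, ρ k (s k j) else 0) =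
        ∑ j, ∏ j', (if j' = j then D j fun k => s k j' else 1) * w j' fun k => s k j' := by
    intro s
    have hsum : ∀ j, ∏ j', (if j' = j then D j fun k => s k j' else 1) * w j' (fun k => s k j') =
        (D j fun k => s k j) * ∏ j', w j' fun k => s k j' := fun j => by
      rw [prod_mul_distrib, prod_ite_eq' univ j]
      simp
    simp only [hsum, ← sum_mul]
    split_ifs with h
    · congr 1
      · simp only [uTen, D, ← sum_sub_distrib]
        refine sum_congr rfl fun j _ => ?_
        congr 2
        refine funext fun k => ?_
        rcases eq_or_ne k i with rfl | hk
        · simp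
        · simp [update_of_ne hk]
      · exact prod_congr rfl fun j _ => (if_pos (congrFun h j)).symm
    · obtain ⟨j, hj⟩ := Function.ne_iff.1 h
      rw [prod_eq_zero (mem_univ j) (if_neg hj), mul_zero]
  rw [sum_congr rfl fun s _ => hterm s, sum_comm]
  refine sum_nonpos fun j _ => ?_
  rw [sum_prod_copies_eq_prod_sum fun j' p => (if j' = j then D j p else 1) * w j' p,
    ← mul_prod_erase univ _ (mem_univ j)]
  refine mul_nonpos_of_nonpos_of_nonneg ?_ (prod_nonneg fun j' hj' => sum_nonneg fun p _ => ?_)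
  · have key := sum_sum_update_eq (hρ i).2 fun c p =>
      if c = r j then u i (update p i (t j)) - u i p else 0
    have h : ∑ p, (if j = j then D j p else 1) * w j p =
        ∑ p : ∀ k, C k, (∏ k, ρ k (p k)) *
          (if p i = r j then u i (update p i (t j)) - u i p else 0) :=
      sum_congr rfl fun p _ => by
        simp only [if_true, D, w]
        split_ifs <;> ring
    rw [h, ← key, sum_eq_single (r j)]
    · refine le_of_eq_of_le ?_ (hnash i (r j) (t j))
      simp only [if_true, update_idem, ← mul_sum, mul_sub, sum_sub_distrib, deviationPayoff]
    · intro c _ hc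
      simp [hc]
    · simp
  · rw [if_neg (ne_of_mem_erase hj'), one_mul]
    simp only [w]
    split_ifs
    exacts [hnn p, le_rfl]

end Powers

section Exchangeable

variable {G : Type*} [Group G] {I : Type*} {C : I → Type*}
  {u : ∀ i : I, (∀ j, C j) → ℝ} (A : GameAction G C u) (m : ℕ)

lemma isClosed_powInv : IsClosed (powInv A m) := by
  simp only [powInv, Set.ofPred_forall]
  exact isClosed_iInter fun g => isClosed_iInter fun σ =>
    isClosed_eq (by fun_prop) (by fun_prop)

lemma convex_powInv : Convex ℝ (powInv A m) := by
  intro π hπ τ hτ a b _ _ _ g σ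
  have h₁ := hπ g σ
  have h₂ := hτ g σ
  ext s
  simp only [Pi.add_apply, Pi.smul_apply, congrFun h₁ s, congrFun h₂ s]

variable [Fintype I] [∀ i, Fintype (C i)]

lemma isCompact_gInvProd : IsCompact (gInvProd A) := by
  have hprod : IsCompact ((fun (ρ : ∀ i, C i → ℝ) (s : ∀ i, C i) => ∏ i, ρ i (s i)) ''
      Set.univ.pi fun i => stdSimplex ℝ (C i)) :=
    (isCompact_univ_pi fun i => isCompact_stdSimplex ℝ (C i)).image (by fun_prop)
  have hinv : IsClosed {π : (∀ j, C j) → ℝ | ∀ g : G, (fun s => π (A.actS g s)) = π} := by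
    rw [Set.ofPred_forall]
    exact isClosed_iInter fun g => isClosed_eq (by fun_prop) (by fun_prop)
  convert hprod.inter_right hinv using 1
  ext π
  simp [gInvProd, Set.mem_image, eq_comm]

instance : CompactSpace ↥(gInvProd A) :=
  isCompact_iff_compactSpace.1 (isCompact_gInvProd A)

lemma isClosed_ceTen (u : ∀ i : I, (∀ j, C j) → ℝ) : IsClosed (ceTen u m) := by
  simp only [ceTen, Set.ofPred_and, Set.ofPred_forall]
  refine (isCompact_stdSimplex ℝ _).isClosed.inter
    (isClosed_iInter fun i => isClosed_iInter fun r => isClosed_iInter fun t =>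
      isClosed_le (continuous_finsetSum _ fun s _ => ?_) continuous_const)
  split_ifs <;> fun_prop

lemma convex_ceTen (u : ∀ i : I, (∀ j, C j) → ℝ) : Convex ℝ (ceTen u m) := by
  intro π hπ τ hτ a b ha hb hab
  refine ⟨convex_stdSimplex ℝ _ hπ.1 hτ.1 ha hb hab, fun i r t => ?_⟩
  have h := add_nonpos (mul_nonpos_of_nonneg_of_nonpos ha (hπ.2 i r t))
    (mul_nonpos_of_nonneg_of_nonpos hb (hτ.2 i r t))
  rw [mul_sum, mul_sum, ← sum_add_distrib] at h
  refine le_of_eq_of_le (sum_congr rfl fun s _ => ?_) h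
  simp only [Pi.add_apply, Pi.smul_apply, smul_eq_mul]
  split_ifs <;> ring

lemma isCompact_prodPow (C : I → Type*) [∀ i, Fintype (C i)] : IsCompact (prodPow C m) := by
  have h : IsCompact ((fun (ρ : ∀ i, Fin m → C i → ℝ) (s : ∀ i, Fin m → C i) =>
      ∏ i, ∏ j, ρ i j (s i j)) '' Set.univ.pi fun i => Set.univ.pi fun _ => stdSimplex ℝ (C i)) :=
    (isCompact_univ_pi fun i => isCompact_univ_pi fun _ => isCompact_stdSimplex ℝ (C i)).image
      (by fun_prop)
  convert h using 1
  ext π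
  simp [prodPow, Set.mem_image, eq_comm]

lemma isClosed_xeM : IsClosed (xeM A m) :=
  (isCompact_convexHull_of_finiteDimensional
    ((isCompact_prodPow m C).inter_right (isClosed_powInv A m))).isClosed.inter
    ((isClosed_ceTen m u).inter (isClosed_powInv A m))

lemma convex_xeM : Convex ℝ (xeM A m) :=
  (convex_convexHull ℝ _).inter ((convex_ceTen m u).inter (convex_powInv A m))

lemma continuous_prod_copies (s : ∀ i, Fin m → C i) :
    Continuous fun ρ : ↥(gInvProd A) => ∏ j, (ρ : (∀ j, C j) → ℝ) fun i => s i j :=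
  continuous_finsetProd _ fun j _ => (continuous_apply _).comp continuous_subtype_val

lemma continuous_muM : Continuous (muM A m) :=
  continuous_pi fun s => ProbabilityMeasure.continuous_integral_boundedContinuousFunction
    (BoundedContinuousFunction.mkOfCompact ⟨_, continuous_prod_copies A m s⟩)

lemma isCompact_xeInf : IsCompact (xeInf A) :=
  (isClosed_biInter fun m _ => (isClosed_xeM A m).preimage (continuous_muM A m)).isCompact

lemma integrable_prod_copies (μ : Measure ↥(gInvProd A)) [IsFiniteMeasure μ]
    (s : ∀ i, Fin m → C i) :
    Integrable (fun ρ : ↥(gInvProd A) => ∏ j, (ρ : (∀ j, C j) → ℝ) fun i => s i j) μ :=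
  (BoundedContinuousFunction.mkOfCompact ⟨_, continuous_prod_copies A m s⟩).integrable μ

variable {A} in
lemma muM_eq_of_eq_add {π π₁ π₂ : ProbabilityMeasure ↥(gInvProd A)} {a b : ℝ≥0}
    (h : (π : Measure ↥(gInvProd A)) = a • (π₁ : Measure ↥(gInvProd A)) + b • (π₂ : Measure _)) :
    muM A m π = (a : ℝ) • muM A m π₁ + (b : ℝ) • muM A m π₂ := by
  ext s
  simp only [muM, h, Pi.add_apply, Pi.smul_apply]
  rw [integral_add_measure (integrable_prod_copies A m _ s) (integrable_prod_copies A m _ s),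
    integral_smul_nnreal_measure, integral_smul_nnreal_measure]
  rfl

lemma nonempty_xeInf [∀ i, Nonempty (C i)] : (xeInf A).Nonempty := by
  obtain ⟨ρ, hinv, hρ, hnash⟩ := A.exists_invariant_nash
  let p : ↥(gInvProd A) := ⟨fun s => ∏ i, ρ i (s i), ⟨ρ, hρ, rfl⟩, fun g => funext fun s =>
    GameAction.prod_actS hinv g s⟩
  refine ⟨diracProba p, Set.mem_iInter₂.2 fun m _ => ?_⟩
  have hmu : muM A m (diracProba p) = fun s => ∏ j, ∏ i, ρ i (s i j) := by
    ext s
    simp only [muM, diracProba, ProbabilityMeasure.coe_mk]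
    rw [integral_dirac]
  have hpow : (fun s : ∀ i, Fin m → C i => ∏ j, ∏ i, ρ i (s i j)) ∈ powInv A m := by
    intro g σ
    ext s
    simp only [powAct]
    rw [← Equiv.prod_comp σ⁻¹ fun j => ∏ i, ρ i (s i j)]
    exact prod_congr rfl fun j _ => GameAction.prod_actS hinv g _
  rw [Set.mem_preimage, hmu]
  refine ⟨subset_convexHull ℝ _ ⟨⟨fun i _ => ρ i, fun i _ => hρ i, ?_⟩, hpow⟩,
    prod_prod_mem_ceTen hρ hnash m, hpow⟩
  exact funext fun s => prod_comm

end Exchangeable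

/-- A game with a finite symmetry group `G` has an order `∞` `G`-exchangeable
equilibrium; indeed `XE_G^∞(Γ)` is a nonempty, compact, convex subset of the space of
Borel probability measures on `Δ_G^Π(Γ)` with the weak topology (convexity phrased via
mixtures of the underlying measures). -/
theorem order_inf_exchangeable_equilibrium_exists
    {G : Type*} [Group G] [Fintype G]
    {I : Type*} [Fintype I] {C : I → Type*} [∀ i, Fintype (C i)]
    (hI : 2 ≤ Fintype.card I) (hC : ∀ i, 2 ≤ Fintype.card (C i))
    (u : ∀ i : I, (∀ j, C j) → ℝ) (A : GameAction G C u) :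
    (xeInf A).Nonempty ∧
    IsCompact (xeInf A) ∧
    (∀ π₁ ∈ xeInf A, ∀ π₂ ∈ xeInf A, ∀ a : ℝ≥0, a ≤ 1 →
      ∀ π : ProbabilityMeasure ↥(gInvProd A),
        (π : Measure ↥(gInvProd A)) =
          a • (π₁ : Measure ↥(gInvProd A)) + (1 - a) • (π₂ : Measure ↥(gInvProd A)) →
        π ∈ xeInf A) := by
  have : ∀ i, Nonempty (C i) := fun i =>
    Fintype.card_pos_iff.1 (zero_lt_two.trans_le (hC i))
  refine ⟨nonempty_xeInf A, isCompact_xeInf A, fun π₁ h₁ π₂ h₂ a ha π hπ => ?_⟩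
  refine Set.mem_iInter₂.2 fun m hm => ?_
  rw [Set.mem_preimage, muM_eq_of_eq_add m hπ]
  exact convex_xeM A m (Set.mem_iInter₂.1 h₁ m hm) (Set.mem_iInter₂.1 h₂ m hm) a.2 (1 - a).2
    (by rw [← NNReal.coe_add, add_tsub_cancel_of_le ha, NNReal.coe_one])
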